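/- Let φ ∈ K(z) have degree d ≥ 2 with normalized homogeneous lift [F,G]. Then the reduction φ_v lies outside the indeterminacy locus I(d) if and only if for every n ≥ 1 one has R_{φⁿ} = N_n · R_φ, where N_n = dⁿ(dⁿ−1)/(d(d−1)). -/

import Mathlib

open MvPolynomial Matrix

noncomputable section

variable {R : Type*} [CommRing R]

def coeffVec (e : ℕ) (F : MvPolynomial (Fin 2) R) (i : Fin (e + 1)) : R :=
  MvPolynomial.coeff (Finsupp.single 0 (e - (i : ℕ)) + Finsupp.single 1 (i : ℕ)) F

def sylv (e : ℕ) (a b : Fin (e + 1) → R) : Matrix (Fin (e + e)) (Fin (e + e)) R :=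
  Matrix.of fun i j =>
    if h : (i : ℕ) < e then
      if hj : (i : ℕ) ≤ (j : ℕ) ∧ (j : ℕ) ≤ (i : ℕ) + e then
        a ⟨(j : ℕ) - (i : ℕ), by omega⟩ else 0
    else
      if hj : (i : ℕ) - e ≤ (j : ℕ) ∧ (j : ℕ) ≤ (i : ℕ) then
        b ⟨(j : ℕ) - ((i : ℕ) - e), by omega⟩ else 0

def bres (e : ℕ) (F G : MvPolynomial (Fin 2) R) : R :=
  (sylv e (coeffVec e F) (coeffVec e G)).det

def comp2 (F f g : MvPolynomial (Fin 2) R) : MvPolynomial (Fin 2) R :=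
  MvPolynomial.aeval ![f, g] F

def pairIter (F G : MvPolynomial (Fin 2) R) : ℕ → MvPolynomial (Fin 2) R × MvPolynomial (Fin 2) R
  | 0 => (X 0, X 1)
  | n + 1 => (comp2 F (pairIter F G n).1 (pairIter F G n).2,
              comp2 G (pairIter F G n).1 (pairIter F G n).2)

variable (K : Type) [NontriviallyNormedField K] [IsUltrametricDist K]

def ordv (x : K) : ℝ := -Real.log ‖x‖

def intRing : Subring K where
  carrier := {x : K | ‖x‖ ≤ 1}
  one_mem' := by simp
  zero_mem' := by simp
  mul_mem' := by
    intro a b ha hb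
    simp only [Set.mem_setOf_eq] at *
    calc ‖a * b‖ = ‖a‖ * ‖b‖ := norm_mul a b
    _ ≤ 1 * 1 := by gcongr
    _ = 1 := by ring
  add_mem' := by
    intro a b ha hb
    simp only [Set.mem_setOf_eq] at *
    exact (IsUltrametricDist.norm_add_le_max a b).trans (max_le ha hb)
  neg_mem' := by
    intro a ha
    simp only [Set.mem_setOf_eq, norm_neg] at *
    exact ha

def maxIdl : Ideal (intRing K) where
  carrier := {x | ‖(x : K)‖ < 1}
  zero_mem' := by simp
  add_mem' := by
    intro a b ha hb
    simp only [Set.mem_setOf_eq] at *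
    exact lt_of_le_of_lt (IsUltrametricDist.norm_add_le_max (a : K) b) (max_lt ha hb)
  smul_mem' := by
    intro c x hx
    simp only [Set.mem_setOf_eq] at *
    calc ‖((c • x : intRing K) : K)‖ = ‖(c : K)‖ * ‖(x : K)‖ := norm_mul _ _
    _ ≤ 1 * ‖(x : K)‖ := by gcongr; exact c.2
    _ < 1 := by simpa using hx

def kk := intRing K ⧸ maxIdl K

instance : CommRing (kk K) := Ideal.Quotient.commRing (maxIdl K)

def redCoeff (x : K) : kk K :=
  if h : ‖x‖ ≤ 1 then Ideal.Quotient.mk (maxIdl K) ⟨x, h⟩ else 0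

def redPoly (F : MvPolynomial (Fin 2) K) : MvPolynomial (Fin 2) (kk K) :=
  ∑ m ∈ F.support, MvPolynomial.monomial m (redCoeff K (F.coeff m))

/-- A pair of binary forms is a (homogeneous) lift of a degree-`d` rational map if both entries
are homogeneous of degree `d` and they are coprime. -/
def LiftPair (d : ℕ) (F G : MvPolynomial (Fin 2) K) : Prop :=
  F.IsHomogeneous d ∧ G.IsHomogeneous d ∧ IsRelPrime F G

/-- A pair of binary forms is normalized if all coefficients lie in `O`
and some coefficient has absolute value `1`. -/
def Normalized (F G : MvPolynomial (Fin 2) K) : Prop :=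
  (∀ m, ‖F.coeff m‖ ≤ 1) ∧ (∀ m, ‖G.coeff m‖ ≤ 1) ∧
    (∃ m, ‖F.coeff m‖ = 1 ∨ ‖G.coeff m‖ = 1)

/-- The maximum of the absolute values of the coefficients of a pair of degree-`e` binary forms. -/
def maxNorm (e : ℕ) (F G : MvPolynomial (Fin 2) K) : ℝ :=
  Finset.univ.sup' Finset.univ_nonempty
    (fun i : Fin (e + 1) => max ‖coeffVec e F i‖ ‖coeffVec e G i‖)

/-- `Rpair e F G` is the quantity `R_φ = ord(Res(F₀,G₀))` where `(F₀,G₀)` is the normalized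
rescaling of the pair `(F,G)` of degree-`e` binary forms; equivalently it is
`ord(Res(F,G)) - 2·e·(minimal ord of a coefficient of F, G)`. -/
def Rpair (e : ℕ) (F G : MvPolynomial (Fin 2) K) : ℝ :=
  ordv K (bres e F G) + 2 * e * Real.log (maxNorm K e F G)

/-- Linear substitution of a `2×2` matrix into a binary form. -/
def mobius (M : Matrix (Fin 2) (Fin 2) K) (F : MvPolynomial (Fin 2) K) :
    MvPolynomial (Fin 2) K :=
  MvPolynomial.aeval
    ![C (M 0 0) * X 0 + C (M 0 1) * X 1, C (M 1 0) * X 0 + C (M 1 1) * X 1] F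

/-- The conjugate pair `γ⁻¹ ∘ (F,G) ∘ γ`, a homogeneous lift of `φ^γ = γ⁻¹ ∘ φ ∘ γ`. -/
def conjPair (M : GL (Fin 2) K) (F G : MvPolynomial (Fin 2) K) :
    MvPolynomial (Fin 2) K × MvPolynomial (Fin 2) K :=
  (C ((M⁻¹ : GL (Fin 2) K) 0 0) * mobius K M F + C ((M⁻¹ : GL (Fin 2) K) 0 1) * mobius K M G,
   C ((M⁻¹ : GL (Fin 2) K) 1 0) * mobius K M F + C ((M⁻¹ : GL (Fin 2) K) 1 1) * mobius K M G)

/-- The minimal resultant `R_{[φ]} = inf_γ R_{φ^γ}` of (the map lifted by) a degree-`e` pair. -/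
def Rmin (e : ℕ) (F G : MvPolynomial (Fin 2) K) : ℝ :=
  ⨅ M : GL (Fin 2) K, Rpair K e (conjPair K M F G).1 (conjPair K M F G).2

/-- `Ilocus d F G` says the reduction of the normalized pair `(F,G)` lies in the indeterminacy
locus `I(d)`: the reduced pair is proportional, i.e. `(F̃, G̃) = (a·C, b·C)` with `[a:b] ∈ P¹(k)`
(so that the residue map is the constant `[a:b]`), and the constant value `[a:b]`
is a root of the common factor `C` (which is the gcd `Ã` of `F̃` and `G̃`). -/
def Ilocus (d : ℕ) (F G : MvPolynomial (Fin 2) K) : Prop :=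
  ∃ (a b : kk K) (Cf : MvPolynomial (Fin 2) (kk K)),
    ¬(a = 0 ∧ b = 0) ∧ Cf.IsHomogeneous d ∧
    redPoly K F = MvPolynomial.C a * Cf ∧ redPoly K G = MvPolynomial.C b * Cf ∧
    MvPolynomial.eval ![a, b] Cf = 0

/-- `Semistable d F G` says the reduction of the normalized pair `(F,G)` is GIT-semistable
(Silverman's numerical criterion): writing `F̃ = Ã·F̃₀`, `G̃ = Ã·G̃₀` with `F̃₀, G̃₀` coprime,
every root `h = [a:b]` of `Ã` has multiplicity `r ≤ d/2` (`d` even), resp. `r ≤ (d+1)/2`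
(`d` odd), and when the bound is attained additionally `φ̃(h) ≠ h`. -/
def Semistable (d : ℕ) (F G : MvPolynomial (Fin 2) K) : Prop :=
  ∃ (A F0 G0 : MvPolynomial (Fin 2) (kk K)) (e : ℕ),
    e ≤ d ∧ A.IsHomogeneous (d - e) ∧ F0.IsHomogeneous e ∧ G0.IsHomogeneous e ∧
    redPoly K F = A * F0 ∧ redPoly K G = A * G0 ∧ IsRelPrime F0 G0 ∧
    ∀ (a b : kk K), ¬(a = 0 ∧ b = 0) → ∀ r : ℕ,
      (MvPolynomial.C b * X 0 - MvPolynomial.C a * X 1) ^ r ∣ A →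
        2 * r ≤ d + 1 ∧
          (d ≤ 2 * r →
            b * MvPolynomial.eval ![a, b] F0 ≠ a * MvPolynomial.eval ![a, b] G0)

/-- The rational map lifted by the (not necessarily normalized) pair `(F,G)` has semistable
reduction: some normalized rescaling is `Semistable`. -/
def HasSemistableRed (d : ℕ) (F G : MvPolynomial (Fin 2) K) : Prop :=
  ∃ c : Kˣ, Normalized K ((c : K) • F) ((c : K) • G) ∧
    Semistable K d ((c : K) • F) ((c : K) • G)

/-- The reduction of (a normalized rescaling of) the pair `(F,G)` lies outside `I(d)`. -/
def RedOutsideI (d : ℕ) (F G : MvPolynomial (Fin 2) K) : Prop :=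
  ∃ c : Kˣ, Normalized K ((c : K) • F) ((c : K) • G) ∧
    ¬ Ilocus K d ((c : K) • F) ((c : K) • G)

/-- The `m`-th term (`m ≥ 1`) of Tate's series `x(w)`. -/
def tateTerm (q w : K) (m : ℕ) : K :=
  q ^ m * w / (1 - q ^ m * w) ^ 2 + q ^ m * w⁻¹ / (1 - q ^ m * w⁻¹) ^ 2
    - 2 * (q ^ m / (1 - q ^ m) ^ 2)

/-- Tate's series `x(w)` for the Tate curve with parameter `q`. -/
def xTate (q w : K) : K :=
  w / (1 - w) ^ 2 + ∑' m : ℕ, tateTerm K q w (m + 1)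


theorem resultant_mul_left_of_natDegree_le {A : Type*} [CommRing A] (f₁ f₂ g : Polynomial A)
    (m₁ m₂ n : ℕ) (h₁ : f₁.natDegree ≤ m₁) (h₂ : f₂.natDegree ≤ m₂) (hg : g.natDegree ≤ n) :
    Polynomial.resultant (f₁ * f₂) g (m₁ + m₂) n =
      Polynomial.resultant f₁ g m₁ n * Polynomial.resultant f₂ g m₂ n := by
  obtain ⟨k₁, rfl⟩ := Nat.exists_eq_add_of_le h₁
  obtain ⟨k₂, rfl⟩ := Nat.exists_eq_add_of_le h₂
  have h : (f₁ * f₂).natDegree ≤ f₁.natDegree + f₂.natDegree := Polynomial.natDegree_mul_le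
  rw [show f₁.natDegree + k₁ + (f₂.natDegree + k₂) =
      f₁.natDegree + f₂.natDegree + (k₁ + k₂) by ring,
    Polynomial.resultant_add_left_deg _ _ _ _ _ h, Polynomial.resultant_mul_left _ _ _ _ hg,
    Polynomial.resultant_add_left_deg _ _ _ _ _ le_rfl,
    Polynomial.resultant_add_left_deg _ _ _ _ _ le_rfl]
  ring

theorem resultant_mul_right_of_natDegree_le {A : Type*} [CommRing A] (f g₁ g₂ : Polynomial A)
    (m n₁ n₂ : ℕ) (hf : f.natDegree ≤ m) (h₁ : g₁.natDegree ≤ n₁) (h₂ : g₂.natDegree ≤ n₂) :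
    Polynomial.resultant f (g₁ * g₂) m (n₁ + n₂) =
      Polynomial.resultant f g₁ m n₁ * Polynomial.resultant f g₂ m n₂ := by
  rw [Polynomial.resultant_comm, resultant_mul_left_of_natDegree_le _ _ _ _ _ _ h₁ h₂ hf,
    Polynomial.resultant_comm f g₁, Polynomial.resultant_comm f g₂]
  ring

theorem natDegree_multiset_prod_map_le {A ι : Type*} [CommRing A] (s : Multiset ι)
    (f : ι → Polynomial A) (e : ℕ) (hf : ∀ i, (f i).natDegree ≤ e) :
    (s.map f).prod.natDegree ≤ s.card * e := by
  induction s using Multiset.induction_on with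
  | empty => simp
  | cons a s ih =>
    rw [Multiset.map_cons, Multiset.prod_cons, Multiset.card_cons, add_mul, one_mul, add_comm]
    exact Polynomial.natDegree_mul_le_of_le (hf a) ih

theorem resultant_multiset_prod_left {A ι : Type*} [CommRing A] (s : Multiset ι)
    (f : ι → Polynomial A) (g : Polynomial A) (e n : ℕ) (hf : ∀ i, (f i).natDegree ≤ e)
    (hg : g.natDegree ≤ n) :
    Polynomial.resultant (s.map f).prod g (s.card * e) n =
      (s.map fun i => Polynomial.resultant (f i) g e n).prod := by
  induction s using Multiset.induction_on with
  | empty => simp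
  | cons a s ih =>
    rw [Multiset.map_cons, Multiset.prod_cons, Multiset.card_cons, add_mul, one_mul,
      add_comm (s.card * e), resultant_mul_left_of_natDegree_le _ _ _ _ _ _ (hf a)
      (natDegree_multiset_prod_map_le s f e hf) hg, ih, Multiset.map_cons, Multiset.prod_cons]

theorem resultant_multiset_prod_right {A ι : Type*} [CommRing A] (s : Multiset ι)
    (f : Polynomial A) (g : ι → Polynomial A) (m e : ℕ) (hf : f.natDegree ≤ m)
    (hg : ∀ i, (g i).natDegree ≤ e) :
    Polynomial.resultant f (s.map g).prod m (s.card * e) =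
      (s.map fun i => Polynomial.resultant f (g i) m e).prod := by
  induction s using Multiset.induction_on with
  | empty => simp
  | cons a s ih =>
    rw [Multiset.map_cons, Multiset.prod_cons, Multiset.card_cons, add_mul, one_mul,
      add_comm (s.card * e), resultant_mul_right_of_natDegree_le _ _ _ _ _ _ hf (hg a)
      (natDegree_multiset_prod_map_le s g e hg), ih, Multiset.map_cons, Multiset.prod_cons]

/-- The linear combination `α p + β q` of two polynomials, with `c = (α, β)`. -/
def linComb {A : Type*} [CommRing A] (p q : Polynomial A) (c : A × A) : Polynomial A :=
  Polynomial.C c.1 * p + Polynomial.C c.2 * q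

theorem natDegree_linComb_le {A : Type*} [CommRing A] {p q : Polynomial A} {e : ℕ}
    (hp : p.natDegree ≤ e) (hq : q.natDegree ≤ e) (c : A × A) :
    (linComb p q c).natDegree ≤ e :=
  Polynomial.natDegree_add_le_of_degree_le ((Polynomial.natDegree_C_mul_le _ _).trans hp)
    ((Polynomial.natDegree_C_mul_le _ _).trans hq)

theorem resultant_linComb {L : Type*} [Field L] {p q : Polynomial L} {e : ℕ}
    (hp : p.natDegree ≤ e) (hq : q.natDegree ≤ e) (a b : L × L) :
    Polynomial.resultant (linComb p q a) (linComb p q b) e e =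
      (a.1 * b.2 - a.2 * b.1) ^ e * Polynomial.resultant p q e e := by
  by_cases ha : a.1 = 0
  · have h : linComb p q b =
        Polynomial.C b.1 * p + q * Polynomial.C b.2 := by rw [linComb]; ring
    have hs : (-1 : L) ^ (e * e) = (-1) ^ e := by
      rw [pow_mul]
      rcases neg_one_pow_eq_or L e with hs | hs <;> simp [hs]
    rw [h, linComb, ha, map_zero, zero_mul, zero_add, Polynomial.resultant_C_mul_left,
      Polynomial.resultant_add_mul_right _ _ _ _ _ (by simp) hq, Polynomial.resultant_C_mul_right,
      Polynomial.resultant_comm q p, zero_mul, zero_sub, hs, ← neg_one_mul (a.2 * b.1),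
      mul_pow, mul_pow]
    ring
  · have h : linComb p q b = Polynomial.C ((a.1 * b.2 - a.2 * b.1) / a.1) * q +
        linComb p q a * Polynomial.C (b.1 / a.1) := by
      have h₁ : b.1 = a.1 * (b.1 / a.1) := by field_simp
      have h₂ : b.2 = (a.1 * b.2 - a.2 * b.1) / a.1 + a.2 * (b.1 / a.1) := by field_simp; ring
      have h₃ := congrArg Polynomial.C h₁
      have h₄ := congrArg Polynomial.C h₂
      rw [map_mul] at h₃
      rw [map_add, map_mul Polynomial.C a.2] at h₄
      rw [linComb, h₃, h₄, linComb]
      ring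
    rw [h, Polynomial.resultant_add_mul_right _ _ _ _ _ (by simp) (natDegree_linComb_le hp hq a),
      Polynomial.resultant_C_mul_right, linComb, mul_comm (Polynomial.C a.2),
      Polynomial.resultant_add_mul_left _ _ _ _ _ (by simp) hq, Polynomial.resultant_C_mul_left,
      ← mul_assoc, ← mul_pow, div_mul_cancel₀ _ ha]

theorem natDegree_aeval_le_of_isHomogeneous {A : Type*} [CommRing A] {F : MvPolynomial (Fin 2) A}
    {d e : ℕ} (hF : F.IsHomogeneous d) {p q : Polynomial A} (hp : p.natDegree ≤ e)
    (hq : q.natDegree ≤ e) : (MvPolynomial.aeval ![p, q] F).natDegree ≤ d * e := by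
  rw [MvPolynomial.aeval_def, MvPolynomial.eval₂_eq']
  refine Polynomial.natDegree_sum_le_of_forall_le _ _ fun m hm => ?_
  have hd : m 0 + m 1 = d := by
    have := hF (MvPolynomial.mem_support_iff.mp hm)
    simpa [Finsupp.weight_apply, Finsupp.sum_fintype, Fin.sum_univ_two] using this
  rw [← hd, add_mul, Fin.prod_univ_two]
  refine (Polynomial.natDegree_C_mul_le _ _).trans (Polynomial.natDegree_mul_le_of_le ?_ ?_)
  · exact Polynomial.natDegree_pow_le_of_le _ hp
  · exact Polynomial.natDegree_pow_le_of_le _ hq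

theorem coeff_aeval_one_X {A : Type*} [CommRing A] {F : MvPolynomial (Fin 2) A} {d : ℕ}
    (hF : F.IsHomogeneous d) {i : ℕ} (hi : i ≤ d) :
    (MvPolynomial.aeval ![(1 : Polynomial A), Polynomial.X] F).coeff i =
      F.coeff (Finsupp.single 0 (d - i) + Finsupp.single 1 i) := by
  rw [MvPolynomial.aeval_def, MvPolynomial.eval₂_eq', Polynomial.finsetSum_coeff,
    Finset.sum_eq_single (Finsupp.single 0 (d - i) + Finsupp.single 1 i)]
  · simp [Fin.prod_univ_two]
  · intro m hm hne
    have hd : m 0 + m 1 = d := by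
      have := hF (MvPolynomial.mem_support_iff.mp hm)
      simpa [Finsupp.weight_apply, Finsupp.sum_fintype, Fin.sum_univ_two] using this
    have hi' : i ≠ m 1 := by
      rintro rfl
      apply hne
      ext j
      fin_cases j
      · simp; omega
      · simp
    simp [Fin.prod_univ_two, Polynomial.coeff_X_pow, hi']
  · intro h
    rw [MvPolynomial.notMem_support_iff.mp h, map_zero, zero_mul, Polynomial.coeff_zero]

theorem exists_eq_C_mul_prod_linear {L : Type*} [Field L] [IsAlgClosed L]
    {F : MvPolynomial (Fin 2) L} {d : ℕ} (hF : F.IsHomogeneous d) :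
    ∃ (c : L) (s : Multiset (L × L)), s.card = d ∧
      F = MvPolynomial.C c *
        (s.map fun a => MvPolynomial.C a.1 * X 0 + MvPolynomial.C a.2 * X 1).prod := by
  set p : Polynomial L := MvPolynomial.aeval ![Polynomial.X, 1] F with hp
  have hdeg : p.natDegree ≤ d := by
    simpa using natDegree_aeval_le_of_isHomogeneous (e := 1) hF Polynomial.natDegree_X_le
      (by simp : (1 : Polynomial L).natDegree ≤ 1)
  have hroots : p.roots.card = p.natDegree := (IsAlgClosed.splits p).natDegree_eq_card_roots.symm
  refine ⟨p.leadingCoeff, p.roots.map (fun r => (1, -r)) +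
    Multiset.replicate (d - p.natDegree) (0, 1), ?_, ?_⟩
  · simp [hroots, hdeg]
  · rw [← Polynomial.homogenize_eq_of_isHomogeneous hF hp.symm]
    apply Polynomial.homogenize_eq_of_isHomogeneous
    · have h : (p.roots.map (fun r => ((1 : L), -r)) +
          Multiset.replicate (d - p.natDegree) (0, 1)).card = d := by simp [hroots, hdeg]
      apply MvPolynomial.IsHomogeneous.C_mul
      conv => arg 2; rw [← h]
      generalize p.roots.map (fun r => ((1 : L), -r)) +
          Multiset.replicate (d - p.natDegree) (0, 1) = s
      induction s using Multiset.induction_on with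
      | empty => simpa using MvPolynomial.isHomogeneous_one _ _
      | cons a s ih =>
        rw [Multiset.map_cons, Multiset.prod_cons, Multiset.card_cons, add_comm s.card]
        exact ((MvPolynomial.isHomogeneous_C_mul_X _ _).add
          (MvPolynomial.isHomogeneous_C_mul_X _ _)).mul ih
    · rw [map_mul, map_multiset_prod, Multiset.map_map, Multiset.map_add, Multiset.prod_add,
        Multiset.map_map]
      simpa [Function.comp_def, ← sub_eq_add_neg, ← Polynomial.C_eq_algebraMap] using
        Polynomial.C_leadingCoeff_mul_prod_multiset_X_sub_C hroots

theorem resultant_prod_linComb {L : Type*} [Field L] {p q : Polynomial L} {e : ℕ}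
    (hp : p.natDegree ≤ e) (hq : q.natDegree ≤ e) (c c' : L) (s t : Multiset (L × L)) :
    Polynomial.resultant (Polynomial.C c * (s.map (linComb p q)).prod)
        (Polynomial.C c' * (t.map (linComb p q)).prod) (s.card * e) (t.card * e) =
      (c ^ t.card * c' ^ s.card *
          (s.map fun a => (t.map fun b => a.1 * b.2 - a.2 * b.1).prod).prod) ^ e *
        Polynomial.resultant p q e e ^ (s.card * t.card) := by
  have hlin := natDegree_linComb_le hp hq
  rw [Polynomial.resultant_C_mul_left, Polynomial.resultant_C_mul_right,
    resultant_multiset_prod_left _ _ _ _ _ hlin (natDegree_multiset_prod_map_le t _ e hlin)]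
  simp_rw [resultant_multiset_prod_right t _ _ _ _ (hlin _) hlin, resultant_linComb hp hq,
    Multiset.prod_map_mul, Multiset.prod_map_pow, Multiset.map_const', Multiset.prod_replicate,
    ← pow_mul]
  ring

theorem resultant_aeval {L : Type*} [Field L] [IsAlgClosed L] {F G : MvPolynomial (Fin 2) L}
    {d e : ℕ} (hF : F.IsHomogeneous d) (hG : G.IsHomogeneous d) {p q : Polynomial L}
    (hp : p.natDegree ≤ e) (hq : q.natDegree ≤ e) :
    Polynomial.resultant (MvPolynomial.aeval ![p, q] F) (MvPolynomial.aeval ![p, q] G)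
        (d * e) (d * e) =
      ((-1) ^ (d * d) * Polynomial.resultant (MvPolynomial.aeval ![1, Polynomial.X] F)
        (MvPolynomial.aeval ![1, Polynomial.X] G) d d) ^ e *
        Polynomial.resultant p q e e ^ (d * d) := by
  obtain ⟨c, s, hs, rfl⟩ := exists_eq_C_mul_prod_linear hF
  obtain ⟨c', t, ht, rfl⟩ := exists_eq_C_mul_prod_linear hG
  have key : ∀ (u v : Polynomial L) (c : L) (s : Multiset (L × L)),
      MvPolynomial.aeval ![u, v] (MvPolynomial.C c *
        (s.map fun a => MvPolynomial.C a.1 * X 0 + MvPolynomial.C a.2 * X 1).prod) =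
      Polynomial.C c * (s.map (linComb u v)).prod := by
    intro u v c s
    rw [map_mul, map_multiset_prod, Multiset.map_map]
    simp only [map_add, map_mul, Function.comp_def, aeval_X, algHom_C,
      Matrix.cons_val_zero, Matrix.cons_val_one, ← Polynomial.C_eq_algebraMap]
    rfl
  have h₁ := resultant_prod_linComb hp hq c c' s t
  have h₂ := resultant_prod_linComb (by simp : (1 : Polynomial L).natDegree ≤ 1)
    Polynomial.natDegree_X_le c c' s t
  have h₃ : Polynomial.resultant (1 : Polynomial L) Polynomial.X 1 1 = -1 := by simp
  rw [hs, ht] at h₁ h₂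
  rw [h₃, mul_one, pow_one] at h₂
  rw [key, key, key, key]
  have h₄ : (-1 : L) ^ (d * d) * (-1) ^ (d * d) = 1 := by
    rw [← mul_pow, neg_one_mul, neg_neg, one_pow]
  rw [h₁, h₂, mul_comm _ ((-1 : L) ^ (d * d)), ← mul_assoc ((-1 : L) ^ (d * d)), h₄, one_mul]

theorem bres_eq_resultant {A : Type*} [CommRing A] {F G : MvPolynomial (Fin 2) A} {e : ℕ}
    (hF : F.IsHomogeneous e) (hG : G.IsHomogeneous e) :
    bres e F G = Polynomial.resultant (MvPolynomial.aeval ![1, Polynomial.X] G)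
      (MvPolynomial.aeval ![1, Polynomial.X] F) e e := by
  rw [bres, ← Matrix.det_transpose, Polynomial.resultant]
  congr 1
  ext i j
  rw [Matrix.transpose_apply, sylv, Polynomial.sylvester, Matrix.of_apply, Matrix.of_apply]
  refine Fin.addCases (fun j => ?_) (fun j => ?_) j
  · rw [Fin.addCases_left, dif_pos (by simp)]
    simp only [Fin.val_castAdd, Set.mem_Icc]
    split_ifs with h
    · rw [coeff_aeval_one_X hF (by omega)]
      rfl
    · rfl
  · rw [Fin.addCases_right, dif_neg (by simp)]
    simp only [Fin.val_natAdd, Set.mem_Icc, add_comm e (j : ℕ)]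
    split_ifs with h h' h'
    · rw [coeff_aeval_one_X hG (by omega)]
      simp only [coeffVec, Nat.add_sub_cancel]
    · omega
    · omega
    · rfl

theorem comp2_isHomogeneous {A : Type*} [CommRing A] {F f g : MvPolynomial (Fin 2) A} {d e : ℕ}
    (hF : F.IsHomogeneous d) (hf : f.IsHomogeneous e) (hg : g.IsHomogeneous e) :
    (comp2 F f g).IsHomogeneous (e * d) :=
  hF.aeval _ fun i => by fin_cases i <;> simpa

theorem pairIter_isHomogeneous {A : Type*} [CommRing A] {F G : MvPolynomial (Fin 2) A} {d : ℕ}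
    (hF : F.IsHomogeneous d) (hG : G.IsHomogeneous d) (n : ℕ) :
    (pairIter F G n).1.IsHomogeneous (d ^ n) ∧ (pairIter F G n).2.IsHomogeneous (d ^ n) := by
  induction n with
  | zero => exact ⟨MvPolynomial.isHomogeneous_X _ _, MvPolynomial.isHomogeneous_X _ _⟩
  | succ n ih =>
    rw [pow_succ]
    exact ⟨comp2_isHomogeneous hF ih.1 ih.2, comp2_isHomogeneous hG ih.1 ih.2⟩

theorem norm_bres_comp2 {L : Type*} [NormedField L] [IsAlgClosed L]
    {F G f g : MvPolynomial (Fin 2) L} {d e : ℕ} (hF : F.IsHomogeneous d)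
    (hG : G.IsHomogeneous d) (hf : f.IsHomogeneous e) (hg : g.IsHomogeneous e) :
    ‖bres (d * e) (comp2 F f g) (comp2 G f g)‖ = ‖bres d F G‖ ^ e * ‖bres e f g‖ ^ (d * d) := by
  have hdeg : ∀ {f : MvPolynomial (Fin 2) L}, f.IsHomogeneous e →
      (MvPolynomial.aeval ![(1 : Polynomial L), Polynomial.X] f).natDegree ≤ e := fun hf => by
    simpa using natDegree_aeval_le_of_isHomogeneous (e := 1) hf
      (by simp : (1 : Polynomial L).natDegree ≤ 1) Polynomial.natDegree_X_le
  have hcomp : ∀ H : MvPolynomial (Fin 2) L,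
      MvPolynomial.aeval ![(1 : Polynomial L), Polynomial.X] (comp2 H f g) =
        MvPolynomial.aeval ![MvPolynomial.aeval ![(1 : Polynomial L), Polynomial.X] f,
          MvPolynomial.aeval ![(1 : Polynomial L), Polynomial.X] g] H := by
    intro H
    rw [comp2, ← AlgHom.comp_apply, MvPolynomial.comp_aeval]
    congr 2
    ext i
    fin_cases i <;> rfl
  have hF' := comp2_isHomogeneous hF hf hg
  have hG' := comp2_isHomogeneous hG hf hg
  rw [mul_comm e d] at hF' hG'
  rw [bres_eq_resultant hF' hG', hcomp, hcomp, resultant_aeval hG hF (hdeg hf) (hdeg hg),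
    bres_eq_resultant hF hG, bres_eq_resultant hf hg,
    Polynomial.resultant_comm (MvPolynomial.aeval ![(1 : Polynomial L), Polynomial.X] g)]
  simp

theorem norm_bres_pairIter {L : Type*} [NormedField L] [IsAlgClosed L]
    {F G : MvPolynomial (Fin 2) L} {d : ℕ} (hd : 2 ≤ d) (hF : F.IsHomogeneous d)
    (hG : G.IsHomogeneous d) (n : ℕ) :
    ∃ N : ℕ, (N : ℝ) = (d : ℝ) ^ n * ((d : ℝ) ^ n - 1) / ((d : ℝ) * ((d : ℝ) - 1)) ∧
      ‖bres (d ^ n) (pairIter F G n).1 (pairIter F G n).2‖ = ‖bres d F G‖ ^ N := by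
  have hd' : (2 : ℝ) ≤ d := by exact_mod_cast hd
  have h0 : (d : ℝ) ≠ 0 := by linarith
  have h1 : (d : ℝ) - 1 ≠ 0 := by linarith
  induction n with
  | zero =>
    refine ⟨0, by simp, ?_⟩
    have hX := bres_eq_resultant (MvPolynomial.isHomogeneous_X L (0 : Fin 2))
      (MvPolynomial.isHomogeneous_X L (1 : Fin 2))
    simp only [pow_zero, pairIter]
    rw [hX, MvPolynomial.aeval_X, MvPolynomial.aeval_X]
    simp
  | succ n ih =>
    obtain ⟨N, hN, hb⟩ := ih
    have hh := pairIter_isHomogeneous hF hG n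
    refine ⟨d ^ n + N * (d * d), ?_, ?_⟩
    · push_cast
      rw [hN]
      field_simp
      ring
    · rw [pow_succ' d n, pairIter, norm_bres_comp2 hF hG hh.1 hh.2, hb]
      ring

theorem aeval_mul_of_isHomogeneous {A B : Type*} [CommRing A] [CommRing B] [Algebra A B]
    {F : MvPolynomial (Fin 2) A} {d : ℕ} (hF : F.IsHomogeneous d) (t u v : B) :
    MvPolynomial.aeval ![t * u, t * v] F = t ^ d * MvPolynomial.aeval ![u, v] F := by
  simp only [MvPolynomial.aeval_def, MvPolynomial.eval₂_eq', Finset.mul_sum]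
  refine Finset.sum_congr rfl fun m hm => ?_
  have hd : m 0 + m 1 = d := by
    have := hF (MvPolynomial.mem_support_iff.mp hm)
    simpa [Finsupp.weight_apply, Finsupp.sum_fintype, Fin.sum_univ_two] using this
  rw [← hd, Fin.prod_univ_two, Fin.prod_univ_two]
  simp only [Matrix.cons_val_zero, Matrix.cons_val_one]
  ring

theorem exists_linear_relation_of_comp2_eq_zero {L : Type*} [Field L] [IsAlgClosed L]
    {H f g : MvPolynomial (Fin 2) L} {d : ℕ} (hH : H.IsHomogeneous d) (hH0 : H ≠ 0)
    (h : comp2 H f g = 0) :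
    ∃ a b : L, ¬(a = 0 ∧ b = 0) ∧ MvPolynomial.C b * f = MvPolynomial.C a * g := by
  obtain ⟨c, s, -, rfl⟩ := exists_eq_C_mul_prod_linear hH
  have hc : (MvPolynomial.C c : MvPolynomial (Fin 2) L) ≠ 0 := left_ne_zero_of_mul hH0
  have hs := right_ne_zero_of_mul hH0
  rw [comp2, map_mul, map_multiset_prod, Multiset.map_map, MvPolynomial.algHom_C,
    MvPolynomial.algebraMap_eq, mul_eq_zero, or_iff_right hc, Multiset.prod_eq_zero_iff,
    Multiset.mem_map] at h
  obtain ⟨a, ha, hz⟩ := h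
  simp only [Function.comp_apply, map_add, map_mul, MvPolynomial.aeval_X, MvPolynomial.algHom_C,
    MvPolynomial.algebraMap_eq, Matrix.cons_val_zero, Matrix.cons_val_one] at hz
  refine ⟨-a.2, a.1, ?_, ?_⟩
  · rintro ⟨h₂, h₁⟩
    refine hs (Multiset.prod_eq_zero (Multiset.mem_map.mpr ⟨a, ha, ?_⟩))
    rw [h₁, neg_eq_zero.mp h₂]
    simp
  · rw [map_neg]
    linear_combination hz

theorem pairIter_linearly_independent {L : Type*} [Field L] [IsAlgClosed L]
    {F G : MvPolynomial (Fin 2) L} {d : ℕ} (hF : F.IsHomogeneous d) (hG : G.IsHomogeneous d)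
    (h : ∀ a b : L, MvPolynomial.C b * F = MvPolynomial.C a * G → a = 0 ∧ b = 0) (n : ℕ) :
    ∀ a b : L, MvPolynomial.C b * (pairIter F G n).1 = MvPolynomial.C a * (pairIter F G n).2 →
      a = 0 ∧ b = 0 := by
  induction n with
  | zero =>
    intro a b hab
    have h₁ := congrArg (MvPolynomial.eval ![(1 : L), 0]) hab
    have h₂ := congrArg (MvPolynomial.eval ![(0 : L), 1]) hab
    simp [pairIter] at h₁ h₂
    exact ⟨h₂.symm, h₁⟩
  | succ n ih =>
    intro a b hab
    by_contra hne
    have hH : MvPolynomial.C b * F - MvPolynomial.C a * G ≠ 0 := fun hz =>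
      hne (h a b (sub_eq_zero.mp hz))
    obtain ⟨a', b', hne', hab'⟩ := exists_linear_relation_of_comp2_eq_zero
      (f := (pairIter F G n).1) (g := (pairIter F G n).2)
      ((hF.C_mul b).sub (hG.C_mul a)) hH (by
        rw [comp2, map_sub, map_mul, map_mul, MvPolynomial.algHom_C, MvPolynomial.algHom_C]
        exact sub_eq_zero.mpr hab)
    exact hne' (ih a' b' hab')

theorem eval_comp2 {A : Type*} [CommRing A] (F f g : MvPolynomial (Fin 2) A) (x : Fin 2 → A) :
    MvPolynomial.eval x (comp2 F f g) =
      MvPolynomial.eval ![MvPolynomial.eval x f, MvPolynomial.eval x g] F := by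
  rw [comp2, MvPolynomial.aeval_def, MvPolynomial.algebraMap_eq, MvPolynomial.eval_eval₂]
  rw [MvPolynomial.eval, MvPolynomial.coe_eval₂Hom]
  congr 1
  · ext; simp
  · ext i
    fin_cases i <;> rfl

theorem eval_pairIter_of_proportional {L : Type*} [Field L] {C₀ : MvPolynomial (Fin 2) L} {d : ℕ}
    (hC : C₀.IsHomogeneous d) {a b : L} (hab : MvPolynomial.eval ![a, b] C₀ ≠ 0) (n : ℕ) :
    ∃ t : L, t ≠ 0 ∧
      MvPolynomial.eval ![a, b]
        (pairIter (MvPolynomial.C a * C₀) (MvPolynomial.C b * C₀) n).1 = t * a ∧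
      MvPolynomial.eval ![a, b]
        (pairIter (MvPolynomial.C a * C₀) (MvPolynomial.C b * C₀) n).2 = t * b := by
  induction n with
  | zero => exact ⟨1, one_ne_zero, by simp [pairIter], by simp [pairIter]⟩
  | succ n ih =>
    obtain ⟨t, ht, h₁, h₂⟩ := ih
    have h : MvPolynomial.eval ![t * a, t * b] C₀ = t ^ d * MvPolynomial.eval ![a, b] C₀ :=
      aeval_mul_of_isHomogeneous hC t a b
    refine ⟨t ^ d * MvPolynomial.eval ![a, b] C₀, mul_ne_zero (pow_ne_zero _ ht) hab, ?_, ?_⟩ <;>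
    · rw [pairIter, eval_comp2, h₁, h₂, map_mul, MvPolynomial.eval_C, h]
      ring

theorem pairIter_ne_zero {L : Type*} [Field L] [IsAlgClosed L]
    {F G : MvPolynomial (Fin 2) L} {d : ℕ} (hF : F.IsHomogeneous d) (hG : G.IsHomogeneous d)
    (h : ∀ (a b : L) (C₀ : MvPolynomial (Fin 2) L), ¬(a = 0 ∧ b = 0) → C₀.IsHomogeneous d →
      F = MvPolynomial.C a * C₀ → G = MvPolynomial.C b * C₀ → MvPolynomial.eval ![a, b] C₀ ≠ 0)
    (n : ℕ) : ¬((pairIter F G n).1 = 0 ∧ (pairIter F G n).2 = 0) := by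
  rintro ⟨h₁, h₂⟩
  by_cases hi : ∀ a b : L, MvPolynomial.C b * F = MvPolynomial.C a * G → a = 0 ∧ b = 0
  · have := pairIter_linearly_independent hF hG hi n 1 1 (by rw [h₁, h₂])
    simp at this
  · push Not at hi
    obtain ⟨a, b, hab, hne⟩ := hi
    have hne' : ¬(a = 0 ∧ b = 0) := fun h' => hne h'.1 h'.2
    obtain ⟨C₀, hC, rfl, rfl⟩ : ∃ C₀ : MvPolynomial (Fin 2) L, C₀.IsHomogeneous d ∧
        F = MvPolynomial.C a * C₀ ∧ G = MvPolynomial.C b * C₀ := by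
      by_cases ha : a = 0
      · have hb : b ≠ 0 := hne ha
        refine ⟨MvPolynomial.C b⁻¹ * G, hG.C_mul _, ?_, ?_⟩
        · rw [ha, map_zero, zero_mul] at hab ⊢
          exact (mul_eq_zero.mp hab).resolve_left (by simpa using hb)
        · rw [← mul_assoc, ← map_mul, mul_inv_cancel₀ hb, map_one, one_mul]
      · refine ⟨MvPolynomial.C a⁻¹ * F, hF.C_mul _, ?_, ?_⟩
        · rw [← mul_assoc, ← map_mul, mul_inv_cancel₀ ha, map_one, one_mul]
        · rw [mul_left_comm, hab, ← mul_assoc, ← map_mul, inv_mul_cancel₀ ha, map_one, one_mul]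
    have he := h a b C₀ hne' hC rfl rfl
    obtain ⟨t, ht, h₃, h₄⟩ := eval_pairIter_of_proportional hC he n
    rw [h₁, map_zero] at h₃
    rw [h₂, map_zero] at h₄
    exact hne' ⟨(mul_eq_zero.mp h₃.symm).resolve_left ht, (mul_eq_zero.mp h₄.symm).resolve_left ht⟩

theorem pairIter_two_eq_zero {A : Type*} [CommRing A] {C₀ : MvPolynomial (Fin 2) A} {d : ℕ}
    (hC : C₀.IsHomogeneous d) {a b : A} (hab : MvPolynomial.eval ![a, b] C₀ = 0) :
    pairIter (MvPolynomial.C a * C₀) (MvPolynomial.C b * C₀) 2 = 0 := by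
  have hX : ∀ H : MvPolynomial (Fin 2) A, comp2 H (X 0) (X 1) = H := by
    intro H
    have : (![X 0, X 1] : Fin 2 → MvPolynomial (Fin 2) A) = X := by
      ext1 i
      fin_cases i <;> rfl
    rw [comp2, this, MvPolynomial.aeval_X_left, AlgHom.id_apply]
  have h := aeval_mul_of_isHomogeneous hC C₀ (MvPolynomial.C a) (MvPolynomial.C b)
  have hz : MvPolynomial.aeval ![MvPolynomial.C a, MvPolynomial.C b] C₀ =
      (MvPolynomial.C (MvPolynomial.eval ![a, b] C₀) : MvPolynomial (Fin 2) A) := by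
    rw [MvPolynomial.aeval_def, MvPolynomial.algebraMap_eq, MvPolynomial.eval,
      MvPolynomial.coe_eval₂Hom, MvPolynomial.eval₂_comp_left]
    congr 1
    ext1 i
    fin_cases i <;> rfl
  rw [hz, hab, map_zero, mul_zero] at h
  simp only [pairIter, hX]
  simp only [comp2, map_mul, mul_comm _ C₀, h]
  simp

theorem intRing_valuation_integers (K : Type) [NontriviallyNormedField K] [IsUltrametricDist K] :
    (NormedField.valuation (K := K)).Integers (intRing K) where
  hom_inj := Subtype.val_injective
  map_le_one x := x.2
  exists_of_le_one {x} hx := ⟨⟨x, hx⟩, rfl⟩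

theorem maxIdl_isMaximal (K : Type) [NontriviallyNormedField K] [IsUltrametricDist K] :
    (maxIdl K).IsMaximal := by
  refine Ideal.isMaximal_iff.2 ⟨fun h => ?_, fun J x _ hx hxJ => ?_⟩
  · have h1 : ‖((1 : intRing K) : K)‖ < 1 := h
    simp at h1
  · have hx1 : ‖(x : K)‖ = 1 := le_antisymm x.2 (not_lt.1 hx)
    have hx0 : (x : K) ≠ 0 := norm_ne_zero_iff.1 (by rw [hx1]; exact one_ne_zero)
    have hinv : (x : K)⁻¹ ∈ intRing K := by
      change ‖(x : K)⁻¹‖ ≤ 1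
      rw [norm_inv, hx1, inv_one]
    have h := J.mul_mem_left ⟨(x : K)⁻¹, hinv⟩ hxJ
    convert h
    exact Subtype.ext (inv_mul_cancel₀ hx0).symm

theorem isAlgClosed_of_surjective_intRing {K : Type} [NontriviallyNormedField K]
    [IsUltrametricDist K] [IsAlgClosed K] {L : Type*} [Field L] (φ : intRing K →+* L)
    (hφ : Function.Surjective φ) : IsAlgClosed L := by
  refine IsAlgClosed.of_exists_root L fun p hp hirr => ?_
  have hlift : p ∈ Polynomial.lifts φ := Polynomial.mem_lifts_of_surjective hφ p
  obtain ⟨q, rfl, hdeg, hq⟩ := Polynomial.lifts_and_natDegree_eq_and_monic hlift hp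
  have hne : (q.map (intRing K).subtype).degree ≠ 0 := by
    rw [hq.degree_map, Polynomial.degree_eq_natDegree hq.ne_zero, hdeg]
    exact_mod_cast hirr.natDegree_pos.ne'
  obtain ⟨x, hx⟩ := IsAlgClosed.exists_root _ hne
  have hx' : Polynomial.eval₂ (intRing K).subtype x q = 0 := by
    rwa [Polynomial.IsRoot, Polynomial.eval_map] at hx
  obtain ⟨y, rfl⟩ : ∃ y : intRing K, (intRing K).subtype y = x :=
    ⟨⟨x, (intRing_valuation_integers K).mem_of_integral ⟨q, hq, hx'⟩⟩, rfl⟩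
  refine ⟨φ y, ?_⟩
  rw [Polynomial.eval₂_at_apply] at hx'
  have hy : q.eval y = 0 := Subtype.val_injective hx'
  rw [Polynomial.eval_map, Polynomial.eval₂_at_apply, hy, map_zero]

theorem comp2_map {A B : Type*} [CommRing A] [CommRing B] (φ : A →+* B)
    (F f g : MvPolynomial (Fin 2) A) :
    comp2 (MvPolynomial.map φ F) (MvPolynomial.map φ f) (MvPolynomial.map φ g) =
      MvPolynomial.map φ (comp2 F f g) := by
  induction F using MvPolynomial.induction_on with
  | C a => simp [comp2]
  | add p q hp hq => simp_all [comp2]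
  | mul_X p i hp =>
    simp only [comp2, map_mul, MvPolynomial.map_X, MvPolynomial.aeval_X] at hp ⊢
    rw [hp]
    fin_cases i <;> rfl

theorem pairIter_map {A B : Type*} [CommRing A] [CommRing B] (φ : A →+* B)
    (F G : MvPolynomial (Fin 2) A) (n : ℕ) :
    pairIter (MvPolynomial.map φ F) (MvPolynomial.map φ G) n =
      (MvPolynomial.map φ (pairIter F G n).1, MvPolynomial.map φ (pairIter F G n).2) := by
  induction n with
  | zero => simp [pairIter]
  | succ n ih => simp only [pairIter, ih, comp2_map]

theorem exists_map_intRing_eq {K : Type} [NontriviallyNormedField K] [IsUltrametricDist K]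
    {F : MvPolynomial (Fin 2) K} (hF : ∀ m, ‖F.coeff m‖ ≤ 1) :
    ∃ F' : MvPolynomial (Fin 2) (intRing K), MvPolynomial.map (intRing K).subtype F' = F := by
  refine ⟨∑ m ∈ F.support, MvPolynomial.monomial m ⟨F.coeff m, hF m⟩, ?_⟩
  simp only [map_sum, MvPolynomial.map_monomial]
  exact (MvPolynomial.as_sum F).symm

theorem coeff_redPoly {K : Type} [NontriviallyNormedField K] [IsUltrametricDist K]
    (F : MvPolynomial (Fin 2) K) (m : Fin 2 →₀ ℕ) :
    (redPoly K F).coeff m = redCoeff K (F.coeff m) := by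
  have h0 : redCoeff K 0 = 0 := by
    have h : ‖(0 : K)‖ ≤ 1 := by rw [norm_zero]; exact zero_le_one
    exact (dif_pos h).trans (map_zero (Ideal.Quotient.mk (maxIdl K)))
  rw [redPoly, MvPolynomial.coeff_sum]
  simp only [MvPolynomial.coeff_monomial]
  rw [Finset.sum_ite_eq' F.support m]
  split_ifs with h
  · rfl
  · rw [MvPolynomial.notMem_support_iff.1 h, h0]

/-- The quotient map from the ring of integers to the residue field. -/
def intRing.residue (K : Type) [NontriviallyNormedField K] [IsUltrametricDist K] :
    intRing K →+* kk K :=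
  Ideal.Quotient.mk (maxIdl K)

theorem intRing.residue_surjective (K : Type) [NontriviallyNormedField K] [IsUltrametricDist K] :
    Function.Surjective (intRing.residue K) :=
  Ideal.Quotient.mk_surjective

theorem intRing.residue_eq_zero_iff {K : Type} [NontriviallyNormedField K] [IsUltrametricDist K]
    (x : intRing K) : intRing.residue K x = 0 ↔ ‖(x : K)‖ < 1 :=
  Ideal.Quotient.eq_zero_iff_mem

theorem redPoly_map {K : Type} [NontriviallyNormedField K] [IsUltrametricDist K]
    (F : MvPolynomial (Fin 2) (intRing K)) :
    redPoly K (MvPolynomial.map (intRing K).subtype F) =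
      MvPolynomial.map (intRing.residue K) F := by
  ext m
  rw [coeff_redPoly, MvPolynomial.coeff_map, MvPolynomial.coeff_map, redCoeff]
  exact dif_pos (F.coeff m).2

theorem exists_coeffVec_eq {A : Type*} [CommRing A] {F : MvPolynomial (Fin 2) A} {e : ℕ}
    (hF : F.IsHomogeneous e) {m : Fin 2 →₀ ℕ} (hm : F.coeff m ≠ 0) :
    ∃ i : Fin (e + 1), ∀ G : MvPolynomial (Fin 2) A, coeffVec e G i = G.coeff m := by
  have h : m 0 + m 1 = e := by
    have := hF hm
    simpa [Finsupp.weight_apply, Finsupp.sum_fintype, Fin.sum_univ_two] using this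
  refine ⟨⟨m 1, by omega⟩, fun G => ?_⟩
  rw [coeffVec]
  congr 1
  ext j
  fin_cases j
  · simp; omega
  · simp

theorem maxNorm_pos {K : Type} [NontriviallyNormedField K] {F G : MvPolynomial (Fin 2) K} {e : ℕ}
    (hF : F.IsHomogeneous e) (hG : G.IsHomogeneous e) (h : ¬(F = 0 ∧ G = 0)) :
    0 < maxNorm K e F G := by
  obtain ⟨i, hi⟩ : ∃ i : Fin (e + 1), 0 < max ‖coeffVec e F i‖ ‖coeffVec e G i‖ := by
    rcases not_and_or.1 h with h | h <;> obtain ⟨m, hm⟩ := MvPolynomial.ne_zero_iff.1 h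
    · obtain ⟨i, hi⟩ := exists_coeffVec_eq hF hm
      exact ⟨i, lt_max_of_lt_left (by rw [hi]; exact norm_pos_iff.2 hm)⟩
    · obtain ⟨i, hi⟩ := exists_coeffVec_eq hG hm
      exact ⟨i, lt_max_of_lt_right (by rw [hi]; exact norm_pos_iff.2 hm)⟩
  exact (Finset.lt_sup'_iff _).2 ⟨i, Finset.mem_univ i, hi⟩

theorem maxNorm_map_le_one {K : Type} [NontriviallyNormedField K] [IsUltrametricDist K]
    (e : ℕ) (F G : MvPolynomial (Fin 2) (intRing K)) :
    maxNorm K e (MvPolynomial.map (intRing K).subtype F)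
      (MvPolynomial.map (intRing K).subtype G) ≤ 1 := by
  refine Finset.sup'_le _ _ fun i _ => max_le ?_ ?_ <;>
  · rw [coeffVec, MvPolynomial.coeff_map]
    exact (MvPolynomial.coeff _ _ : intRing K).2

theorem maxNorm_map_lt_one_iff {K : Type} [NontriviallyNormedField K] [IsUltrametricDist K]
    {e : ℕ} {F G : MvPolynomial (Fin 2) (intRing K)}
    (hF : F.IsHomogeneous e) (hG : G.IsHomogeneous e) :
    maxNorm K e (MvPolynomial.map (intRing K).subtype F)
      (MvPolynomial.map (intRing K).subtype G) < 1 ↔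
    MvPolynomial.map (intRing.residue K) F = 0 ∧ MvPolynomial.map (intRing.residue K) G = 0 := by
  have key : ∀ {H : MvPolynomial (Fin 2) (intRing K)}, H.IsHomogeneous e →
      ((∀ i, ‖coeffVec e (MvPolynomial.map (intRing K).subtype H) i‖ < 1) ↔
        MvPolynomial.map (intRing.residue K) H = 0) := by
    intro H hH
    refine ⟨fun h => ?_, fun h i => ?_⟩
    · ext m
      rw [MvPolynomial.coeff_map, MvPolynomial.coeff_zero]
      by_cases hm : H.coeff m = 0
      · rw [hm, map_zero]
      · obtain ⟨i, hi⟩ := exists_coeffVec_eq hH hm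
        rw [intRing.residue_eq_zero_iff, ← hi H]
        have := h i
        rwa [coeffVec, MvPolynomial.coeff_map] at this
    · rw [coeffVec, MvPolynomial.coeff_map]
      refine (intRing.residue_eq_zero_iff _).1 ?_
      rw [← MvPolynomial.coeff_map, h, MvPolynomial.coeff_zero]
  rw [← key hF, ← key hG, maxNorm, Finset.sup'_lt_iff, ← forall_and]
  simp only [Finset.mem_univ, true_imp_iff, max_lt_iff]

theorem LiftPair.linearly_independent {K : Type} [NontriviallyNormedField K]
    {F G : MvPolynomial (Fin 2) K} {d : ℕ} (hd : 1 ≤ d) (h : LiftPair K d F G) :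
    ∀ a b : K, MvPolynomial.C b * F = MvPolynomial.C a * G → a = 0 ∧ b = 0 := by
  have hunit : ∀ {H : MvPolynomial (Fin 2) K}, H.IsHomogeneous d → ¬ IsUnit H := by
    intro H hH hu
    have := hu.map (MvPolynomial.constantCoeff (σ := Fin 2) (R := K))
    rw [MvPolynomial.constantCoeff_eq, hH.coeff_eq_zero (by simp; omega)] at this
    exact not_isUnit_zero this
  have hdvd : ∀ {c c' : K} {P Q : MvPolynomial (Fin 2) K}, c ≠ 0 →
      MvPolynomial.C c * P = MvPolynomial.C c' * Q → Q ∣ P := by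
    intro c c' P Q hc hPQ
    refine ⟨MvPolynomial.C (c⁻¹ * c'), ?_⟩
    rw [map_mul, mul_comm Q, mul_assoc, ← hPQ, ← mul_assoc, ← map_mul, inv_mul_cancel₀ hc, map_one,
      one_mul]
  intro a b hab
  by_contra hne
  rcases not_and_or.1 hne with ha | hb
  · exact hunit h.1 (h.2.2 dvd_rfl (hdvd ha hab.symm))
  · exact hunit h.2.1 (h.2.2 (hdvd hb hab) dvd_rfl)

theorem Rpair_pairIter_eq_iff {K : Type} [NontriviallyNormedField K] [IsAlgClosed K]
    {F G : MvPolynomial (Fin 2) K} {d : ℕ} (hd : 2 ≤ d) (hF : F.IsHomogeneous d)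
    (hG : G.IsHomogeneous d) (h1 : maxNorm K d F G = 1) (n : ℕ)
    (hpos : 0 < maxNorm K (d ^ n) (pairIter F G n).1 (pairIter F G n).2)
    (hle : maxNorm K (d ^ n) (pairIter F G n).1 (pairIter F G n).2 ≤ 1) :
    Rpair K (d ^ n) (pairIter F G n).1 (pairIter F G n).2 =
        ((d : ℝ) ^ n * ((d : ℝ) ^ n - 1) / ((d : ℝ) * ((d : ℝ) - 1))) * Rpair K d F G ↔
      ¬ maxNorm K (d ^ n) (pairIter F G n).1 (pairIter F G n).2 < 1 := by
  obtain ⟨N, hN, hres⟩ := norm_bres_pairIter hd hF hG n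
  have hdn : (2 : ℝ) * ((d ^ n : ℕ) : ℝ) ≠ 0 := by
    have : d ≠ 0 := by omega
    positivity
  rw [Rpair, Rpair, ← hN, h1, ordv, ordv, hres, Real.log_pow, Real.log_one, mul_zero, add_zero,
    mul_neg, add_eq_left, mul_eq_zero, or_iff_right hdn, not_lt]
  refine ⟨fun h => ?_, fun h => by rw [le_antisymm hle h, Real.log_one]⟩
  exact (Real.eq_one_of_pos_of_log_eq_zero hpos h).ge

/-- Let `[F,G]` be a normalized lift of a degree-`d ≥ 2` rational map `φ`. Then
the reduction `φ_v` lies outside `I(d)` iff for every `n ≥ 1`, `R_{φⁿ} = N_n · R_φ`, where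
`N_n = dⁿ(dⁿ−1)/(d(d−1))`. -/
theorem outside_indeterminacy_iff_resultant_formula {K : Type} [NontriviallyNormedField K]
    [IsAlgClosed K] [CompleteSpace K] [IsUltrametricDist K] (d : ℕ) (hd : 2 ≤ d)
    (F G : MvPolynomial (Fin 2) K) (hlift : LiftPair K d F G) (hnorm : Normalized K F G) :
    ¬ Ilocus K d F G ↔
      ∀ n : ℕ, 1 ≤ n →
        Rpair K (d ^ n) (pairIter F G n).1 (pairIter F G n).2 =
          ((d : ℝ) ^ n * ((d : ℝ) ^ n - 1) / ((d : ℝ) * ((d : ℝ) - 1))) * Rpair K d F G := by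
  obtain ⟨F, rfl⟩ := exists_map_intRing_eq hnorm.1
  obtain ⟨G, rfl⟩ := exists_map_intRing_eq hnorm.2.1
  have hinj : Function.Injective (intRing K).subtype := Subtype.val_injective
  have hF : F.IsHomogeneous d := hlift.1.of_map hinj
  have hG : G.IsHomogeneous d := hlift.2.1.of_map hinj
  have hred : ¬(MvPolynomial.map (intRing.residue K) F = 0 ∧
      MvPolynomial.map (intRing.residue K) G = 0) := by
    rintro ⟨h₁, h₂⟩
    obtain ⟨m, hm⟩ := hnorm.2.2
    have key : ∀ {H : MvPolynomial (Fin 2) (intRing K)},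
        MvPolynomial.map (intRing.residue K) H = 0 →
        ‖(MvPolynomial.map (intRing K).subtype H).coeff m‖ < 1 := fun {H} h => by
      rw [MvPolynomial.coeff_map]
      refine (intRing.residue_eq_zero_iff _).1 ?_
      rw [← MvPolynomial.coeff_map, h, MvPolynomial.coeff_zero]
    exact hm.elim (key h₁).ne (key h₂).ne
  have hone : maxNorm K d (MvPolynomial.map (intRing K).subtype F)
      (MvPolynomial.map (intRing K).subtype G) = 1 :=
    (maxNorm_map_le_one d F G).eq_of_not_lt fun h => hred ((maxNorm_map_lt_one_iff hF hG).1 h)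
  have hiff : ∀ n : ℕ,
      Rpair K (d ^ n)
          (pairIter (MvPolynomial.map (intRing K).subtype F)
            (MvPolynomial.map (intRing K).subtype G) n).1
          (pairIter (MvPolynomial.map (intRing K).subtype F)
            (MvPolynomial.map (intRing K).subtype G) n).2 =
        ((d : ℝ) ^ n * ((d : ℝ) ^ n - 1) / ((d : ℝ) * ((d : ℝ) - 1))) *
          Rpair K d (MvPolynomial.map (intRing K).subtype F)
            (MvPolynomial.map (intRing K).subtype G) ↔
      ¬((pairIter (MvPolynomial.map (intRing.residue K) F)
          (MvPolynomial.map (intRing.residue K) G) n).1 = 0 ∧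
        (pairIter (MvPolynomial.map (intRing.residue K) F)
          (MvPolynomial.map (intRing.residue K) G) n).2 = 0) := by
    intro n
    have hhom := pairIter_isHomogeneous hlift.1 hlift.2.1 n
    have hhom' := pairIter_isHomogeneous hF hG n
    have hpos := maxNorm_pos hhom.1 hhom.2 fun h => one_ne_zero <|
      (pairIter_linearly_independent hlift.1 hlift.2.1
        (hlift.linearly_independent (by omega)) n 1 1 (by rw [h.1, h.2])).1
    have hle := maxNorm_map_le_one (d ^ n) (pairIter F G n).1 (pairIter F G n).2
    rw [Rpair_pairIter_eq_iff hd hlift.1 hlift.2.1 hone n hpos (by rwa [pairIter_map]),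
      pairIter_map, pairIter_map, maxNorm_map_lt_one_iff hhom'.1 hhom'.2]
  constructor
  · intro hI n _
    rw [hiff]
    let _ : Field (kk K) :=
      have := maxIdl_isMaximal K
      Ideal.Quotient.field (maxIdl K)
    have : IsAlgClosed (kk K) :=
      isAlgClosed_of_surjective_intRing (intRing.residue K) (intRing.residue_surjective K)
    refine pairIter_ne_zero (hF.map _) (hG.map _) (fun a b C₀ hab hC h₁ h₂ h₀ => hI ?_) n
    exact ⟨a, b, C₀, hab, hC, by rw [redPoly_map]; exact h₁, by rw [redPoly_map]; exact h₂, h₀⟩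
  · rintro h ⟨a, b, C₀, -, hC, h₁, h₂, h₀⟩
    refine (hiff 2).1 (h 2 one_le_two) ?_
    rw [redPoly_map] at h₁ h₂
    rw [h₁, h₂, pairIter_two_eq_zero hC h₀]
    exact ⟨rfl, rfl⟩

end
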